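/- arXiv:2012.05066 — 4 statements merged into one kernel-verified Lean document; each statement's English description precedes it below -/
import Mathlib

section
/- For every λ > 0 and real numbers x̲ < x < x̄: (exp(λx̄) − exp(λx))/(exp(λx̄) − exp(λx̲)) > (exp(−λx) − exp(−λx̄))/(exp(−λx̲) − exp(−λx̄)). That is, f_g(x) > f_b(x): the downward-drifting (safe-type) process is strictly more likely than the upward-drifting (risky-type) process to exit the interval (x̲, x̄) through the lower endpoint. (Used in the proof of Lemma 2.) -/
open Real

/-- Passing to reciprocals strictly lowers the relative distance of an interior point to the
upper endpoint of a positive interval. -/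
theorem inv_sub_inv_div_inv_sub_inv_lt {a b c : ℝ} (ha : 0 < a) (hab : a < b) (hbc : b < c) :
    (b⁻¹ - c⁻¹) / (a⁻¹ - c⁻¹) < (c - b) / (c - a) := by
  have hb : 0 < b := ha.trans hab
  have hc : 0 < c := hb.trans hbc
  have hca : 0 < c - a := sub_pos.2 (hab.trans hbc)
  have key : (b⁻¹ - c⁻¹) / (a⁻¹ - c⁻¹) = a / b * ((c - b) / (c - a)) := by
    rw [inv_sub_inv hb.ne' hc.ne', inv_sub_inv ha.ne' hc.ne']
    field_simp
  rw [key]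
  exact mul_lt_of_lt_one_left (div_pos (sub_pos.2 hbc) hca) ((div_lt_one hb).2 hab)

/-- `f_g(x) > f_b(x)`: the downward-drifting (safe-type) process is strictly more likely
than the upward-drifting (risky-type) process to exit the interval `(x̲, x̄)` through the
lower endpoint (used in the proof of Lemma 2). -/
theorem fg_gt_fb (lam xl x xu : ℝ) (hlam : 0 < lam) (h1 : xl < x) (h2 : x < xu) :
    (exp (lam * xu) - exp (lam * x)) / (exp (lam * xu) - exp (lam * xl)) >
      (exp (-lam * x) - exp (-lam * xu)) / (exp (-lam * xl) - exp (-lam * xu)) := by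
  simp only [neg_mul, exp_neg]
  exact inv_sub_inv_div_inv_sub_inv_lt (exp_pos _)
    (exp_lt_exp.2 (mul_lt_mul_of_pos_left h1 hlam))
    (exp_lt_exp.2 (mul_lt_mul_of_pos_left h2 hlam))
end

section
/- For every λ > 0 and real numbers x̲ < x̄, if x̲ < x < (x̲ + x̄)/2 then f_g(x) + f_b(x) > 1, i.e. (exp(λx̄) − exp(λx))/(exp(λx̄) − exp(λx̲)) + (exp(−λx) − exp(−λx̄))/(exp(−λx̲) − exp(−λx̄)) > 1. (Claim in the footnote to the proof of Lemma 2: starting closer to the lower endpoint, the average of the exit-through-the-bottom probabilities of the two drifted processes exceeds one half.) -/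
open Real

/-- For positive `a`, `b`, `c` with `a < c`, the sum of the exit probabilities written in
exponential coordinates exceeds one as soon as `b ^ 2 < a * c`. -/
theorem one_lt_div_add_inv_div {a b c : ℝ} (ha : 0 < a) (hb : 0 < b) (hac : a < c)
    (h : b ^ 2 < a * c) :
    1 < (c - b) / (c - a) + (b⁻¹ - c⁻¹) / (a⁻¹ - c⁻¹) := by
  have hc : 0 < c := ha.trans hac
  have hca : 0 < c - a := sub_pos.2 hac
  have key : (c - b) / (c - a) + (b⁻¹ - c⁻¹) / (a⁻¹ - c⁻¹) =
      (c - b) * (a + b) / (b * (c - a)) := by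
    rw [inv_sub_inv hb.ne' hc.ne', inv_sub_inv ha.ne' hc.ne']
    field_simp
    ring
  rw [key, one_lt_div (mul_pos hb hca)]
  linarith

/-- Footnote to the proof of Lemma 2: starting closer to the lower endpoint, i.e. for
`x̲ < x < (x̲ + x̄)/2`, the exit-through-the-bottom probabilities of the two drifted
processes satisfy `f_g(x) + f_b(x) > 1`. -/
theorem fg_add_fb_gt_one (lam xl x xu : ℝ) (hlam : 0 < lam) (h1 : xl < x)
    (h2 : x < (xl + xu) / 2) :
    (exp (lam * xu) - exp (lam * x)) / (exp (lam * xu) - exp (lam * xl)) +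
      (exp (-lam * x) - exp (-lam * xu)) / (exp (-lam * xl) - exp (-lam * xu)) > 1 := by
  have hac : exp (lam * xl) < exp (lam * xu) :=
    exp_lt_exp.2 (mul_lt_mul_of_pos_left (by linarith) hlam)
  have hsq : exp (lam * x) ^ 2 < exp (lam * xl) * exp (lam * xu) := by
    rw [← exp_nat_mul, ← exp_add, exp_lt_exp]
    push_cast
    nlinarith
  simpa only [neg_mul, exp_neg] using one_lt_div_add_inv_div (exp_pos _) (exp_pos _) hac hsq
end

section
/- For every λ > 0 and real numbers x̲ < x̄, if x̲ < x < (x̲ + x̄)/2 then T_b(x) > T_g(x), where T_g(x) := f_g(x)(x̄ − x̲) − (x̄ − x) and T_b(x) := (x̄ − x) − f_b(x)(x̄ − x̲); equivalently, f_g(x) + f_b(x) < 2(x̄ − x)/(x̄ − x̲). (Step in the proof of Lemma 2: when started in the lower half of the interval, the expected exit time of the upward-drifting risky-type process exceeds that of the downward-drifting safe-type process.) -/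
open Real

/-- `sinh` is strictly convex on the nonnegative reals. -/
lemma strictConvexOn_sinh_Ici : StrictConvexOn ℝ (Set.Ici (0 : ℝ)) sinh := by
  refine strictConvexOn_of_deriv2_pos (convex_Ici 0) continuous_sinh.continuousOn ?_
  intro t ht
  rw [interior_Ici] at ht
  simpa using ht

/-- A chord bound: `sinh a / sinh b < a / b` for `0 < a < b`, with denominators cleared. -/
lemma sinh_mul_lt_mul_sinh {a b : ℝ} (ha : 0 < a) (hab : a < b) :
    sinh a * b < a * sinh b := by
  have hb : 0 < b := ha.trans hab
  have h := strictConvexOn_sinh_Ici.2 (Set.mem_Ici.2 le_rfl) (Set.mem_Ici.2 hb.le) hb.ne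
    (sub_pos.2 ((div_lt_one hb).2 hab)) (div_pos ha hb) (sub_add_cancel 1 (a / b))
  simp only [smul_eq_mul, mul_zero, zero_add, sinh_zero, div_mul_cancel₀ a hb.ne'] at h
  rwa [div_mul_eq_mul_div, lt_div_iff₀ hb] at h

/-- For exit from `(m - d, m + d)` started at `m - y`, the two lower-exit probabilities
add up to `1 + sinh y / sinh d`. -/
lemma exit_probabilities_add (m d y : ℝ) (hd : 0 < d) :
    (exp (m + d) - exp (m - y)) / (exp (m + d) - exp (m - d)) +
        (exp (-(m - y)) - exp (-(m + d))) / (exp (-(m - d)) - exp (-(m + d))) =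
      1 + sinh y / sinh d := by
  have hs : exp d - exp (-d) ≠ 0 := (sub_pos.2 (exp_lt_exp.2 (by linarith))).ne'
  have hg : (exp (m + d) - exp (m - y)) / (exp (m + d) - exp (m - d)) =
      (exp d - exp (-y)) / (exp d - exp (-d)) := by
    rw [sub_eq_add_neg m y, sub_eq_add_neg m d, exp_add, exp_add, exp_add, ← mul_sub, ← mul_sub,
      mul_div_mul_left _ _ (exp_ne_zero m)]
  have hb : (exp (-(m - y)) - exp (-(m + d))) / (exp (-(m - d)) - exp (-(m + d))) =
      (exp y - exp (-d)) / (exp d - exp (-d)) := by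
    rw [show -(m - y) = -m + y by ring, show -(m + d) = -m + -d by ring,
      show -(m - d) = -m + d by ring, exp_add, exp_add, exp_add, ← mul_sub, ← mul_sub,
      mul_div_mul_left _ _ (exp_ne_zero (-m))]
  rw [hg, hb, sinh_eq, sinh_eq, div_div_div_cancel_right₀ two_ne_zero, ← add_div]
  field_simp
  ring

/-- Step in the proof of Lemma 2: when started in the lower half of the interval, the
expected exit time `T_b(x)` of the upward-drifting (risky-type) process exceeds the
expected exit time `T_g(x)` of the downward-drifting (safe-type) process, where
`T_g(x) = f_g(x)(x̄ − x̲) − (x̄ − x)` and `T_b(x) = (x̄ − x) − f_b(x)(x̄ − x̲)`. -/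
theorem Tb_gt_Tg (lam xl x xu : ℝ) (hlam : 0 < lam) (h1 : xl < x)
    (h2 : x < (xl + xu) / 2) :
    (xu - x) -
        (exp (-lam * x) - exp (-lam * xu)) / (exp (-lam * xl) - exp (-lam * xu)) * (xu - xl) >
      (exp (lam * xu) - exp (lam * x)) / (exp (lam * xu) - exp (lam * xl)) * (xu - xl) -
        (xu - x) := by
  have hw : 0 < xu - xl := by linarith
  have hy : 0 < lam * ((xl + xu) / 2 - x) := mul_pos hlam (by linarith)
  have hyd : lam * ((xl + xu) / 2 - x) < lam * ((xu - xl) / 2) :=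
    mul_lt_mul_of_pos_left (by linarith) hlam
  have hd := hy.trans hyd
  have hsum := exit_probabilities_add (lam * ((xl + xu) / 2)) _
    (lam * ((xl + xu) / 2 - x)) hd
  have hu : lam * ((xl + xu) / 2) + lam * ((xu - xl) / 2) = lam * xu := by ring
  have hl : lam * ((xl + xu) / 2) - lam * ((xu - xl) / 2) = lam * xl := by ring
  have hx : lam * ((xl + xu) / 2) - lam * ((xl + xu) / 2 - x) = lam * x := by ring
  rw [hu, hl, hx] at hsum
  have hratio : sinh (lam * ((xl + xu) / 2 - x)) / sinh (lam * ((xu - xl) / 2)) <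
      (xl + xu - 2 * x) / (xu - xl) := by
    have hchord := sinh_mul_lt_mul_sinh hy hyd
    rw [div_lt_div_iff₀ (sinh_pos_iff.2 hd) hw]
    refine lt_of_mul_lt_mul_left ?_ (half_pos hlam).le
    linarith
  have hmul := (lt_div_iff₀ hw).1 hratio
  simp only [neg_mul]
  have hsum' := congrArg (· * (xu - xl)) hsum
  simp only [add_mul, one_mul] at hsum'
  linarith
end

section
/- Let λ > 0, c > 0, and real numbers x̲ < x̄, π, η with η < π. For every x with x̲ < x < (x̲ + x̄)/2: f_g(x)·(π − η) − c·T_g(x) > f_b(x)·(π − η) − c·T_b(x), where T_g(x) := f_g(x)(x̄ − x̲) − (x̄ − x) and T_b(x) := (x̄ − x) − f_b(x)(x̄ − x̲). (Lemma 2: for the strategy that launches at x̲ paying fee η and abandons at x̄, starting from any point in the lower half of the interval, the expected payoff is strictly higher for the safe-type (drift −1) firm than for the risky-type (drift +1) firm.) -/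
open Real

theorem exp_sub_exp_eq_sinh (u v : ℝ) :
    exp u - exp v = 2 * exp ((u + v) / 2) * sinh ((u - v) / 2) := by
  rw [sinh_eq]
  have hu : exp u = exp ((u + v) / 2) * exp ((u - v) / 2) := by
    rw [← exp_add]; congr 1; ring
  have hv : exp v = exp ((u + v) / 2) * exp (-((u - v) / 2)) := by
    rw [← exp_add]; congr 1; ring
  rw [hu, hv]
  ring

theorem exp_sub_exp_div_exp_sub_exp (u v w z : ℝ) :
    (exp u - exp v) / (exp w - exp z) =
      exp ((u + v - w - z) / 2) * (sinh ((u - v) / 2) / sinh ((w - z) / 2)) := by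
  have h : exp ((u + v) / 2) = exp ((u + v - w - z) / 2) * exp ((w + z) / 2) := by
    rw [← exp_add]; congr 1; ring
  rw [exp_sub_exp_eq_sinh u v, exp_sub_exp_eq_sinh w z, h]
  have h0 := (exp_pos ((w + z) / 2)).ne'
  rw [show 2 * (exp ((u + v - w - z) / 2) * exp ((w + z) / 2)) * sinh ((u - v) / 2) =
    (2 * exp ((w + z) / 2)) * (exp ((u + v - w - z) / 2) * sinh ((u - v) / 2)) by ring,
    mul_div_mul_left _ _ (mul_ne_zero two_ne_zero h0), mul_div_assoc]

theorem strictConvexOn_sinh : StrictConvexOn ℝ (Set.Ici 0) sinh := by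
  refine StrictMonoOn.strictConvexOn_of_deriv (convex_Ici 0) continuous_sinh.continuousOn ?_
  rw [Real.deriv_sinh, interior_Ici]
  exact cosh_strictMonoOn.mono Set.Ioi_subset_Ici_self

theorem mul_sinh_lt_mul_sinh {p q : ℝ} (hp : 0 < p) (hpq : p < q) :
    q * sinh p < p * sinh q := by
  have hq : 0 < q := hp.trans hpq
  have h := strictConvexOn_sinh.2 (Set.mem_Ici.2 le_rfl) (Set.mem_Ici.2 hq.le) hq.ne
    (sub_pos.2 ((div_lt_one hq).2 hpq)) (div_pos hp hq) (sub_add_cancel 1 (p / q))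
  simp only [smul_eq_mul, mul_zero, zero_add, sinh_zero, div_mul_cancel₀ p hq.ne'] at h
  calc q * sinh p < q * (p / q * sinh q) := mul_lt_mul_of_pos_left h hq
    _ = p * sinh q := by field_simp

theorem two_mul_cosh_mul_sinh_lt {α β : ℝ} (hα : 0 < α) (hαβ : α < β) :
    2 * cosh α * sinh β * (α + β) < 2 * β * sinh (α + β) := by
  have h := mul_sinh_lt_mul_sinh (sub_pos.2 hαβ) (show β - α < α + β by linarith)
  rw [sinh_sub, sinh_add] at h
  rw [sinh_add]
  nlinarith

/-- Lemma 2: for the strategy that launches at `x̲` paying fee `η < π` and abandons at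
`x̄`, starting from any point `x` in the lower half of the interval, the expected payoff
`f·(π − η) − c·T` is strictly higher for the safe-type (drift −1) firm than for the
risky-type (drift +1) firm, where `f_g, f_b` are the exit probabilities through the lower
endpoint and `T_g(x) = f_g(x)(x̄ − x̲) − (x̄ − x)`, `T_b(x) = (x̄ − x) − f_b(x)(x̄ − x̲)`
are the corresponding expected exit times. -/
theorem good_type_payoff_gt_bad (lam c xl xu profit η x : ℝ) (hlam : 0 < lam) (hc : 0 < c)
    (hη : η < profit) (h1 : xl < x) (h2 : x < (xl + xu) / 2) :
    (exp (lam * xu) - exp (lam * x)) / (exp (lam * xu) - exp (lam * xl)) * (profit - η) -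
        c * ((exp (lam * xu) - exp (lam * x)) / (exp (lam * xu) - exp (lam * xl)) * (xu - xl) -
          (xu - x)) >
      (exp (-lam * x) - exp (-lam * xu)) / (exp (-lam * xl) - exp (-lam * xu)) * (profit - η) -
        c * ((xu - x) -
          (exp (-lam * x) - exp (-lam * xu)) / (exp (-lam * xl) - exp (-lam * xu)) * (xu - xl)) := by
  obtain ⟨α, hα⟩ : ∃ α, α = lam * (x - xl) / 2 := ⟨_, rfl⟩
  obtain ⟨β, hβ⟩ : ∃ β, β = lam * (xu - x) / 2 := ⟨_, rfl⟩
  have hα0 : 0 < α := by rw [hα]; exact half_pos (mul_pos hlam (by linarith))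
  have hαβ : α < β := by
    rw [hα, hβ]
    have := mul_lt_mul_of_pos_left (show x - xl < xu - x by linarith) hlam
    linarith
  have hS : 0 < sinh (α + β) := sinh_pos_iff.2 (by linarith)
  have hB : 0 < sinh β := sinh_pos_iff.2 (by linarith)
  have hg : (exp (lam * xu) - exp (lam * x)) / (exp (lam * xu) - exp (lam * xl)) =
      exp α * (sinh β / sinh (α + β)) := by
    rw [exp_sub_exp_div_exp_sub_exp, hα, hβ]
    ring_nf
  have hb : (exp (-lam * x) - exp (-lam * xu)) / (exp (-lam * xl) - exp (-lam * xu)) =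
      exp (-α) * (sinh β / sinh (α + β)) := by
    rw [exp_sub_exp_div_exp_sub_exp, hα, hβ]
    ring_nf
  rw [hg, hb]
  have hr : 0 < sinh β / sinh (α + β) := div_pos hB hS
  have hprob : exp (-α) * (sinh β / sinh (α + β)) < exp α * (sinh β / sinh (α + β)) :=
    mul_lt_mul_of_pos_right (exp_lt_exp.2 (by linarith)) hr
  have htime : exp α * (sinh β / sinh (α + β)) * (xu - xl) +
      exp (-α) * (sinh β / sinh (α + β)) * (xu - xl) < 2 * (xu - x) := by
    have key := two_mul_cosh_mul_sinh_lt hα0 hαβ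
    have hcosh : exp α + exp (-α) = 2 * cosh α := by rw [cosh_eq]; ring
    rw [show exp α * (sinh β / sinh (α + β)) * (xu - xl) +
      exp (-α) * (sinh β / sinh (α + β)) * (xu - xl) =
      (exp α + exp (-α)) * sinh β * (xu - xl) / sinh (α + β) by ring, hcosh, div_lt_iff₀ hS]
    refine lt_of_mul_lt_mul_left ?_ (half_pos hlam).le
    calc lam / 2 * (2 * cosh α * sinh β * (xu - xl))
        = 2 * cosh α * sinh β * (α + β) := by
          rw [show α + β = lam / 2 * (xu - xl) by rw [hα, hβ]; ring]; ring
      _ < 2 * β * sinh (α + β) := key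
      _ = lam / 2 * (2 * (xu - x) * sinh (α + β)) := by
          rw [show 2 * β = lam * (xu - x) by rw [hβ]; ring]; ring
  have hpay := mul_lt_mul_of_pos_right hprob (sub_pos.2 hη)
  have hcost := mul_lt_mul_of_pos_left htime hc
  linarith
end
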